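/- Let Q_{k+1} = T_AL Q_k be the Advantage Learning iterates from any Q_0 : S × A → ℝ, V_k = V_{Q_k}, π* an optimal deterministic policy, and Δ_k^{π*}(s) = V_k(s) − Q_k(s, π*(s)). Then for every k ≥ 0: ‖V* − V_{k+1}‖_∞ ≤ γ ‖V* − V_k‖_∞ + α ‖Δ_k^{π*}‖_∞. -/

import Mathlib

open Filter Topology Finset

/-- Value function induced by a Q-function: `V_Q(s) = max_a Q(s,a)`. -/
noncomputable def Vof {S A : Type*} [Fintype A] [Nonempty A]
    (Q : S → A → ℝ) (s : S) : ℝ := ⨆ a, Q s a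

/-- Bellman optimality operator `(T Q)(s,a) = r(s,a) + γ Σ_{s'} P(s'|s,a) V_Q(s')`. -/
noncomputable def bellmanOp {S A : Type*} [Fintype S] [Fintype A] [Nonempty A]
    (P : S → A → S → ℝ) (r : S → A → ℝ) (γ : ℝ)
    (Q : S → A → ℝ) : S → A → ℝ :=
  fun s a => r s a + γ * ∑ s', P s a s' * Vof Q s'

/-- Advantage Learning operator `(T_AL Q)(s,a) = (T Q)(s,a) - α (V_Q(s) - Q(s,a))`. -/
noncomputable def alOp {S A : Type*} [Fintype S] [Fintype A] [Nonempty A]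
    (P : S → A → S → ℝ) (r : S → A → ℝ) (γ α : ℝ)
    (Q : S → A → ℝ) : S → A → ℝ :=
  fun s a => bellmanOp P r γ Q s a - α * (Vof Q s - Q s a)

/-- Clipped Advantage Learning operator. -/
noncomputable def clipOp {S A : Type*} [Fintype S] [Fintype A] [Nonempty A]
    (P : S → A → S → ℝ) (r : S → A → ℝ) (γ α c Ql : ℝ)
    (Q : S → A → ℝ) : S → A → ℝ :=
  fun s a => if Q s a - Ql ≥ c * (Vof Q s - Ql)
    then alOp P r γ α Q s a else bellmanOp P r γ Q s a

/-- Sup norm over a finite nonempty domain. -/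
noncomputable def supNorm {S : Type*} [Fintype S] [Nonempty S] (f : S → ℝ) : ℝ :=
  ⨆ s, |f s|

theorem Vof_ge {S A : Type*} [Fintype A] [Nonempty A] (Q : S → A → ℝ) (s : S) (a : A) :
    Q s a ≤ Vof Q s := le_ciSup (f := fun a => Q s a) (Set.finite_range _).bddAbove a

theorem supNorm_ge {S : Type*} [Fintype S] [Nonempty S] (f : S → ℝ) (s : S) :
    |f s| ≤ supNorm f := le_ciSup (f := fun s => |f s|) (Set.finite_range _).bddAbove s

theorem stmt_1
    {S A : Type*} [Fintype S] [Nonempty S] [Fintype A] [Nonempty A]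
    (P : S → A → S → ℝ) (hP0 : ∀ s a s', 0 ≤ P s a s')
    (hP1 : ∀ s a, ∑ s', P s a s' = 1)
    (r : S → A → ℝ) (γ : ℝ) (hγ0 : 0 ≤ γ) (hγ1 : γ < 1)
    (Qstar : S → A → ℝ) (hQstar : bellmanOp P r γ Qstar = Qstar)
    (α : ℝ) (hα0 : 0 ≤ α) (hα1 : α < 1)
    (πstar : S → A) (hπstar : ∀ s, Qstar s (πstar s) = Vof Qstar s)
    (Qseq : ℕ → S → A → ℝ)
    (hQseq : ∀ k, Qseq (k + 1) = alOp P r γ α (Qseq k))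
 :
    ∀ k : ℕ,
      supNorm (fun s => Vof Qstar s - Vof (Qseq (k + 1)) s) ≤
        γ * supNorm (fun s => Vof Qstar s - Vof (Qseq k) s) +
          α * supNorm (fun s => Vof (Qseq k) s - Qseq k s (πstar s)) := by
  intro k
  set N := supNorm (fun s => Vof Qstar s - Vof (Qseq k) s) with hN
  set D := supNorm (fun s => Vof (Qseq k) s - Qseq k s (πstar s)) with hD
  have hNs : ∀ s, |Vof Qstar s - Vof (Qseq k) s| ≤ N := fun s =>
    supNorm_ge (fun s => Vof Qstar s - Vof (Qseq k) s) s
  have hDs : ∀ s, |Vof (Qseq k) s - Qseq k s (πstar s)| ≤ D := fun s =>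
    supNorm_ge (fun s => Vof (Qseq k) s - Qseq k s (πstar s)) s
  have hD0 : 0 ≤ D := (abs_nonneg _).trans (hDs (Classical.arbitrary S))
  have hαD : 0 ≤ α * D := mul_nonneg hα0 hD0
  have key : ∀ s a, |Qstar s a - bellmanOp P r γ (Qseq k) s a| ≤ γ * N := by
    intro s a
    have h1 : Qstar s a - bellmanOp P r γ (Qseq k) s a
        = γ * ∑ s', P s a s' * (Vof Qstar s' - Vof (Qseq k) s') := by
      conv_lhs => rw [← hQstar]
      simp only [bellmanOp, mul_sub, Finset.sum_sub_distrib]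
      ring
    rw [h1, abs_mul, abs_of_nonneg hγ0]
    refine mul_le_mul_of_nonneg_left ?_ hγ0
    calc |∑ s', P s a s' * (Vof Qstar s' - Vof (Qseq k) s')|
        ≤ ∑ s', |P s a s' * (Vof Qstar s' - Vof (Qseq k) s')| := Finset.abs_sum_le_sum_abs _ _
      _ ≤ ∑ s', P s a s' * N := by
          refine Finset.sum_le_sum fun s' _ => ?_
          rw [abs_mul, abs_of_nonneg (hP0 s a s')]
          exact mul_le_mul_of_nonneg_left (hNs s') (hP0 s a s')
      _ = N := by rw [← Finset.sum_mul, hP1, one_mul]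
  refine ciSup_le fun s => ?_
  rw [abs_le]
  constructor
  · have : Vof (Qseq (k + 1)) s ≤ Vof Qstar s + γ * N := by
      refine ciSup_le fun a => ?_
      rw [hQseq]
      have h1 := (abs_le.mp (key s a)).1
      have h2 := Vof_ge Qstar s a
      have h3 := mul_nonneg hα0 (sub_nonneg.mpr (Vof_ge (Qseq k) s a))
      simp only [alOp]
      linarith
    linarith
  · have h0 := Vof_ge (Qseq (k + 1)) s (πstar s)
    rw [hQseq] at h0
    simp only [alOp] at h0
    rw [hQseq]
    have h1 := (abs_le.mp (key s (πstar s))).2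
    have h2 := mul_le_mul_of_nonneg_left ((le_abs_self _).trans (hDs s)) hα0
    rw [hπstar] at h1
    change Vof Qstar s - Vof (fun s a => bellmanOp P r γ (Qseq k) s a - α * (Vof (Qseq k) s - Qseq k s a)) s ≤ _
    change _ ≤ Vof (fun s a => bellmanOp P r γ (Qseq k) s a - α * (Vof (Qseq k) s - Qseq k s a)) s at h0
    linarith
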